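/- Let ν ∈ (−2,−1], let β be the power-law fragment daughter distribution with exponent ν, fix k₀ ∈ (|ν|−1,1), and let Φ be the collision kernel with exponents λ₁ ≤ λ₂ ≤ 1 satisfying λ₁ < |ν|−1 and λ = λ₁+λ₂ < 1. Let T₁ > 0 and let u be a mass-conserving weak solution to the collision-induced fragmentation equation on [0,T₁) with nonnegative initial condition u^in ∈ X_{k₀} ∩ X_{k₀+1} and M₁(u^in) > 0. Then for every T ∈ (0,T₁) and every k ∈ (−∞,1), sup_{t∈[0,T]} M_k(u(t)) < ∞; in particular u^in ∈ X_k for every k ∈ (−∞,1+k₀]. -/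

import Mathlib

open MeasureTheory Set Filter
open scoped ENNReal

noncomputable section

/-- The `k`-th moment `M_k(g) = ∫₀^∞ x^k g(x) dx`. -/
def Mk (k : ℝ) (g : ℝ → ℝ) : ℝ := ∫ x in Ioi (0:ℝ), x ^ k * g x

/-- Membership in the weighted space `X_k`. -/
def MemXk (k : ℝ) (g : ℝ → ℝ) : Prop :=
  MeasureTheory.IntegrableOn (fun x => x ^ k * g x) (Ioi (0:ℝ))

/-- The fragment daughter distribution built from `β_*` via the mass-transfer form
`β(x₃,x₁,x₂) = β_*(x₃,x₁,x₂)·1_{(0,x₁)}(x₃) + β_*(x₃,x₂,x₁)·1_{(0,x₂)}(x₃)`. -/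
def betaOf (bs : ℝ → ℝ → ℝ → ℝ) (x₃ x₁ x₂ : ℝ) : ℝ :=
  (if x₃ ∈ Ioo (0:ℝ) x₁ then bs x₃ x₁ x₂ else 0) +
  (if x₃ ∈ Ioo (0:ℝ) x₂ then bs x₃ x₂ x₁ else 0)

/-- The power-law `β_*(x₃,x₁,x₂) = (ν+2) x₃^ν x₁^{-ν-1} 1_{(0,x₁)}(x₃)`. -/
def betaPow (ν : ℝ) (x₃ x₁ x₂ : ℝ) : ℝ :=
  if x₃ ∈ Ioo (0:ℝ) x₁ then (ν + 2) * x₃ ^ ν * x₁ ^ (-ν - 1) else 0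

/-- The collision kernel `Φ(x₁,x₂) = x₁^{λ₁} x₂^{λ₂} + x₂^{λ₁} x₁^{λ₂}`. -/
def Phi (l₁ l₂ : ℝ) (x₁ x₂ : ℝ) : ℝ := x₁ ^ l₁ * x₂ ^ l₂ + x₂ ^ l₁ * x₁ ^ l₂

/-- `Υ_ς(x₁,x₂) = ∫₀^{x₁+x₂} ς(x₃) β(x₃,x₁,x₂) dx₃ - ς(x₁) - ς(x₂)`, where `β = betaOf bs`. -/
def Upsilon (bs : ℝ → ℝ → ℝ → ℝ) (ς : ℝ → ℝ) (x₁ x₂ : ℝ) : ℝ :=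
  (∫ x₃ in Ioo (0:ℝ) (x₁ + x₂), ς x₃ * betaOf bs x₃ x₁ x₂) - ς x₁ - ς x₂

/-- Assumptions on `β_*`: measurability, nonnegativity, local mass conservation, and the
non-integrability bounds `∫₀^{x₁} x₃^{k₀} β_*(x₃,x₁,x₂)^p dx₃ ≤ E_{k₀,p} x₁^{k₀+1-p}`
for `p ∈ [1,p₀]`, some `p₀ ∈ (1,1+k₀)`. -/
structure FragKernel (k₀ : ℝ) (bs : ℝ → ℝ → ℝ → ℝ) : Prop where
  meas : Measurable fun q : ℝ × ℝ × ℝ => bs q.1 q.2.1 q.2.2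
  nonneg : ∀ x₃ x₁ x₂ : ℝ, 0 ≤ bs x₃ x₁ x₂
  mass : ∀ x₁ ∈ Ioi (0:ℝ), ∀ x₂ ∈ Ioi (0:ℝ),
    ∫ x₃ in Ioo (0:ℝ) x₁, x₃ * bs x₃ x₁ x₂ = x₁
  bound : ∃ p₀ ∈ Ioo (1:ℝ) (1 + k₀), ∀ p ∈ Icc (1:ℝ) p₀, ∃ E : ℝ, 0 < E ∧
    ∀ x₁ ∈ Ioi (0:ℝ), ∀ x₂ ∈ Ioi (0:ℝ),
      ∫ x₃ in Ioo (0:ℝ) x₁, x₃ ^ k₀ * (bs x₃ x₁ x₂) ^ p ≤ E * x₁ ^ (k₀ + 1 - p)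

/-- `ς(0) = 0` and `ς` is Hölder continuous with exponent `k₀` on `[0,∞)`. -/
def HolderZero (k₀ : ℝ) (ς : ℝ → ℝ) : Prop :=
  ς 0 = 0 ∧ ∃ H : ℝ, ∀ a b : ℝ, 0 ≤ a → 0 ≤ b → |ς a - ς b| ≤ H * |a - b| ^ k₀

/-- `ς` is bounded on `[0,∞)`. -/
def BddOnNonneg (ς : ℝ → ℝ) : Prop := ∃ C : ℝ, ∀ x : ℝ, 0 ≤ x → |ς x| ≤ C

/-- A weak solution on `[0,T)` to the collision-induced fragmentation equation with
daughter distribution `betaOf bs` and collision kernel `K`. -/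
structure IsWeakSolution (k₀ : ℝ) (bs : ℝ → ℝ → ℝ → ℝ) (K : ℝ → ℝ → ℝ)
    (uin : ℝ → ℝ) (T : ℝ≥0∞) (u : ℝ → ℝ → ℝ) : Prop where
  meas : Measurable (Function.uncurry u)
  nonneg : ∀ t : ℝ, 0 ≤ t → ENNReal.ofReal t < T → ∀ x ∈ Ioi (0:ℝ), 0 ≤ u t x
  init : ∀ x ∈ Ioi (0:ℝ), u 0 x = uin x
  cont : ∀ g : ℝ → ℝ, Measurable g → (∃ C : ℝ, ∀ x : ℝ, |g x| ≤ C) →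
    ContinuousOn (fun t => ∫ x in Ioi (0:ℝ), g x * (x ^ k₀ * u t x))
      {t : ℝ | 0 ≤ t ∧ ENNReal.ofReal t < T}
  massBdd : ∃ C : ℝ, ∀ t : ℝ, 0 ≤ t → ENNReal.ofReal t < T →
    (∫⁻ x in Ioi (0:ℝ), ENNReal.ofReal (x * u t x)) ≤ ENNReal.ofReal C
  integ : ∀ t : ℝ, 0 < t → ENNReal.ofReal t < T →
    MeasureTheory.IntegrableOn
      (fun q : ℝ × ℝ × ℝ =>
        (q.2.1 ^ k₀ + q.2.2 ^ k₀) * K q.2.1 q.2.2 * u q.1 q.2.1 * u q.1 q.2.2)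
      (Ioo (0:ℝ) t ×ˢ (Ioi (0:ℝ) ×ˢ Ioi (0:ℝ)))
  weak : ∀ t : ℝ, 0 < t → ENNReal.ofReal t < T → ∀ ς : ℝ → ℝ,
    HolderZero k₀ ς → BddOnNonneg ς →
    ∫ x in Ioi (0:ℝ), ς x * u t x =
      (∫ x in Ioi (0:ℝ), ς x * uin x) +
      (1/2) * ∫ τ in Ioo (0:ℝ) t, ∫ x₁ in Ioi (0:ℝ), ∫ x₂ in Ioi (0:ℝ),
        Upsilon bs ς x₁ x₂ * K x₁ x₂ * u τ x₁ * u τ x₂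

/-- Mass conservation on `[0,T)`. -/
def MassConserving (uin : ℝ → ℝ) (T : ℝ≥0∞) (u : ℝ → ℝ → ℝ) : Prop :=
  ∀ t : ℝ, 0 ≤ t → ENNReal.ofReal t < T → Mk 1 (u t) = Mk 1 uin

/-- The formation term `F` with kernel `K`. -/
def Fform (bs : ℝ → ℝ → ℝ → ℝ) (K : ℝ → ℝ → ℝ) (v : ℝ → ℝ) (x₁ : ℝ) : ℝ :=
  (1/2) * ∫ x₂ in Ioi x₁, ∫ x₃ in Ioo (0:ℝ) x₂,
    betaOf bs x₁ (x₂ - x₃) x₃ * K (x₂ - x₃) x₃ * v (x₂ - x₃) * v x₃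

/-- The loss term `L` with kernel `K`. -/
def Lform (K : ℝ → ℝ → ℝ) (v : ℝ → ℝ) (x₁ : ℝ) : ℝ :=
  v x₁ * ∫ x₂ in Ioi (0:ℝ), K x₁ x₂ * v x₂

/-- The norm of `X_{k₀} ∩ X₁`, i.e. the `L¹` norm with weight `x^{k₀} + x`. -/
def N01 (k₀ : ℝ) (g : ℝ → ℝ) : ℝ := ∫ x in Ioi (0:ℝ), (x ^ k₀ + x) * |g x|

/-- The truncated collision kernel `Φ_n`. -/
def PhiTrunc (l₁ l₂ : ℝ) (n : ℕ) (x₁ x₂ : ℝ) : ℝ :=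
  if x₁ ∈ Ioo ((n:ℝ)⁻¹) (n:ℝ) ∧ x₂ ∈ Ioo ((n:ℝ)⁻¹) (n:ℝ) then Phi l₁ l₂ x₁ x₂ else 0

/-- `u` is a continuously differentiable curve in `X_{k₀} ∩ X₁` on `[0,∞)`, with `u(0) = v0`,
solving `∂ₜ u = F u - L u` in the strong (norm) sense; the derivative
`t ↦ F u(t) - L u(t)` is moreover continuous in the norm of `X_{k₀} ∩ X₁`. -/
def SolvesTrunc (k₀ : ℝ) (bs : ℝ → ℝ → ℝ → ℝ) (K : ℝ → ℝ → ℝ) (v0 : ℝ → ℝ)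
    (u : ℝ → ℝ → ℝ) : Prop :=
  Measurable (Function.uncurry u) ∧
  (∀ x ∈ Ioi (0:ℝ), u 0 x = v0 x) ∧
  (∀ t : ℝ, 0 ≤ t → MemXk k₀ (u t) ∧ MemXk 1 (u t)) ∧
  (∀ t : ℝ, 0 ≤ t →
    Tendsto (fun h : ℝ =>
        N01 k₀ (fun x => (u (t + h) x - u t x) / h - (Fform bs K (u t) x - Lform K (u t) x)))
      (nhdsWithin 0 {h : ℝ | h ≠ 0 ∧ 0 ≤ t + h}) (nhds 0)) ∧
  (∀ t₀ : ℝ, 0 ≤ t₀ →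
    Tendsto (fun t : ℝ =>
        N01 k₀ (fun x =>
          (Fform bs K (u t) x - Lform K (u t) x) - (Fform bs K (u t₀) x - Lform K (u t₀) x)))
      (nhdsWithin t₀ (Ici (0:ℝ))) (nhds 0))

/-- Bundled data and standing assumptions of the paper. -/
structure Setup where
  k₀ : ℝ
  l₁ : ℝ
  l₂ : ℝ
  bs : ℝ → ℝ → ℝ → ℝ
  E₁ : ℝ
  uin : ℝ → ℝ
  hk₀ : k₀ ∈ Ioo (0:ℝ) 1
  hl₁ : k₀ ≤ l₁
  hl₁₂ : l₁ ≤ l₂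
  hl₂ : l₂ ≤ 1
  hβ : FragKernel k₀ bs
  hE₁pos : 0 < E₁
  hE₁ : ∀ x₁ ∈ Ioi (0:ℝ), ∀ x₂ ∈ Ioi (0:ℝ),
    ∫ x₃ in Ioo (0:ℝ) x₁, x₃ ^ k₀ * bs x₃ x₁ x₂ ≤ E₁ * x₁ ^ k₀
  hmeas : Measurable uin
  hnn : ∀ x : ℝ, 0 ≤ uin x
  hXk₀ : MemXk k₀ uin
  hX1 : MemXk 1 uin
  hX1k₀ : MemXk (1 + k₀) uin
  hρ : 0 < Mk 1 uin

/-- Apply a function of the seven quantities `k₀, λ₁, λ₂, ρ, M_{k₀}(u^in), M_{k₀+1}(u^in), E_{k₀,1}`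
to the data of a setup. -/
def app7 {α : Sort*} (f : ℝ → ℝ → ℝ → ℝ → ℝ → ℝ → ℝ → α) (S : Setup) : α :=
  f S.k₀ S.l₁ S.l₂ (Mk 1 S.uin) (Mk S.k₀ S.uin) (Mk (S.k₀ + 1) S.uin) S.E₁

/-- A nonnegative `C¹` solution of the truncated equation with truncated initial condition,
satisfying the mass bound and the `(k₀+1)`-moment bound. -/
def IsTruncSolution (S : Setup) (n : ℕ) (u : ℝ → ℝ → ℝ) : Prop :=
  SolvesTrunc S.k₀ S.bs (PhiTrunc S.l₁ S.l₂ n) ((Ioo (0:ℝ) (2 * n)).indicator S.uin) u ∧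
  (∀ t : ℝ, 0 ≤ t → ∀ x ∈ Ioi (0:ℝ), 0 ≤ u t x) ∧
  (∀ t : ℝ, 0 ≤ t → Mk 1 (u t) ≤ Mk 1 S.uin) ∧
  (∀ t : ℝ, 0 ≤ t → Mk (S.k₀ + 1) (u t) ≤ Mk (S.k₀ + 1) S.uin)

end

/-- Truncated test function. -/
noncomputable def sgF (ε x : ℝ) : ℝ := min x ε / ε

/-- Gain part of the test function. -/
noncomputable def BfF (ν ε x : ℝ) : ℝ :=
  ∫ y in Ioo (0:ℝ) x, sgF ε y * ((ν + 2) * y ^ ν * x ^ (-ν - 1))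

lemma sgF_nonneg {ε x : ℝ} (hε : 0 < ε) (hx : 0 ≤ x) : 0 ≤ sgF ε x :=
  div_nonneg (le_min hx hε.le) hε.le

lemma sgF_le_one {ε : ℝ} (x : ℝ) (hε : 0 < ε) : sgF ε x ≤ 1 := by
  unfold sgF; rw [div_le_one hε]; exact min_le_right _ _

lemma sgF_le_div {ε : ℝ} (x : ℝ) (hε : 0 < ε) : sgF ε x ≤ x / ε := by
  unfold sgF; gcongr; exact min_le_left _ _

lemma sgF_le_rpow {ε x k : ℝ} (hε : 0 < ε) (hx : 0 < x) (hk : 0 ≤ k) (hk1 : k ≤ 1) :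
    sgF ε x ≤ (x / ε) ^ k := by
  rcases le_total x ε with h | h
  · calc sgF ε x ≤ (x / ε) ^ (1:ℝ) := by rw [Real.rpow_one]; exact sgF_le_div x hε
      _ ≤ _ := Real.rpow_le_rpow_of_exponent_ge (by positivity) ((div_le_one hε).2 h) hk1
  · exact (sgF_le_one x hε).trans (Real.one_le_rpow ((one_le_div hε).2 h) hk)

lemma sgF_meas (ε : ℝ) : Measurable (sgF ε) := by unfold sgF; fun_prop

lemma sgF_lip {ε : ℝ} (hε : 0 < ε) (a b : ℝ) : |sgF ε a - sgF ε b| ≤ |a - b| / ε := by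
  unfold sgF
  rw [← sub_div, abs_div, abs_of_pos hε]
  refine div_le_div_of_nonneg_right ?_ hε.le
  have h := abs_min_sub_min_le_max a ε b ε
  rwa [sub_self, abs_zero, max_eq_left (abs_nonneg _)] at h

lemma sgF_holder {ε k : ℝ} (hε : 0 < ε) (hk : 0 < k) (hk1 : k ≤ 1) : HolderZero k (sgF ε) := by
  refine ⟨by simp [sgF, hε.le], (1 / ε) ^ k, fun a b ha hb => ?_⟩
  rw [← Real.mul_rpow (by positivity) (by positivity), one_div_mul_eq_div]
  have h1 : |sgF ε a - sgF ε b| ≤ 1 := by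
    rw [abs_le]
    constructor <;> linarith [sgF_nonneg hε ha, sgF_nonneg hε hb, sgF_le_one a hε, sgF_le_one b hε]
  calc |sgF ε a - sgF ε b| = |sgF ε a - sgF ε b| ^ (1:ℝ) := (Real.rpow_one _).symm
    _ ≤ |sgF ε a - sgF ε b| ^ k := by
      rcases (abs_nonneg (sgF ε a - sgF ε b)).eq_or_lt with h | h
      · rw [← h]; simp [hk.ne']
      · exact Real.rpow_le_rpow_of_exponent_ge h h1 hk1
    _ ≤ _ := by gcongr; exact sgF_lip hε a b

lemma rpow_integrableOn {q : ℝ} (hq : -1 < q) (x : ℝ) (hx : 0 < x) :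
    IntegrableOn (fun y : ℝ => y ^ q) (Ioo 0 x) := by
  have := (intervalIntegral.intervalIntegrable_rpow' (a := 0) (b := x) hq)
  rw [intervalIntegrable_iff_integrableOn_Ioo_of_le hx.le] at this
  exact this

lemma rpow_setIntegral {q : ℝ} (hq : -1 < q) (x : ℝ) (hx : 0 < x) :
    ∫ y in Ioo 0 x, y ^ q = x ^ (q + 1) / (q + 1) := by
  rw [← integral_Ioc_eq_integral_Ioo, ← intervalIntegral.integral_of_le hx.le,
    integral_rpow (Or.inl hq), Real.zero_rpow (by linarith), sub_zero]

lemma B_integrable {ν ε x : ℝ} (hν : -2 < ν) (hε : 0 < ε) (hx : 0 < x) :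
    IntegrableOn (fun y => sgF ε y * ((ν + 2) * y ^ ν * x ^ (-ν - 1))) (Ioo 0 x) := by
  have h := ((rpow_integrableOn (q := ν + 1) (by linarith) x hx).const_mul
    ((ν + 2) * x ^ (-ν - 1) / ε))
  refine Integrable.mono' h ?_ ?_
  · have := sgF_meas ε
    exact (by fun_prop : Measurable _).aestronglyMeasurable
  · filter_upwards [ae_restrict_mem measurableSet_Ioo] with y hy
    have hy0 : 0 < y := hy.1
    have h2 : 0 < ν + 2 := by linarith
    rw [Real.norm_of_nonneg (mul_nonneg (sgF_nonneg hε hy0.le) (by positivity)),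
      Real.rpow_add_one hy0.ne']
    calc _ ≤ y / ε * ((ν + 2) * y ^ ν * x ^ (-ν - 1)) := by
          gcongr; exact sgF_le_div y hε
      _ = _ := by ring

lemma ups_eq {ν ε x₁ x₂ : ℝ} (hν : -2 < ν) (hε : 0 < ε) (h1 : 0 < x₁) (h2 : 0 < x₂) :
    Upsilon (betaPow ν) (sgF ε) x₁ x₂ =
      (BfF ν ε x₁ - sgF ε x₁) + (BfF ν ε x₂ - sgF ε x₂) := by
  have key : ∀ x, 0 < x → x ≤ x₁ + x₂ →
      IntegrableOn ((Ioo 0 x).indicator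
        (fun y => sgF ε y * ((ν + 2) * y ^ ν * x ^ (-ν - 1)))) (Ioo 0 (x₁ + x₂)) ∧
      ∫ y in Ioo 0 (x₁ + x₂), (Ioo 0 x).indicator
        (fun y => sgF ε y * ((ν + 2) * y ^ ν * x ^ (-ν - 1))) y = BfF ν ε x := by
    intro x hx hle
    have hs : Ioo 0 x ∩ Ioo 0 (x₁ + x₂) = Ioo 0 x :=
      inter_eq_left.2 (Ioo_subset_Ioo_right hle)
    constructor
    · have : Integrable _ _ := (integrable_indicator_iff measurableSet_Ioo).2
        (B_integrable hν hε hx)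
      exact this.integrableOn
    · rw [integral_indicator measurableSet_Ioo, Measure.restrict_restrict measurableSet_Ioo, hs]
      rfl
  have e1 := key x₁ h1 (by linarith)
  have e2 := key x₂ h2 (by linarith)
  unfold Upsilon
  have : (∫ x₃ in Ioo (0:ℝ) (x₁ + x₂), sgF ε x₃ * betaOf (betaPow ν) x₃ x₁ x₂)
      = BfF ν ε x₁ + BfF ν ε x₂ := by
    rw [← e1.2, ← e2.2, ← integral_add e1.1 e2.1]
    congr 1
    ext y
    simp only [betaOf, betaPow, indicator_apply, mul_add]
    split_ifs <;> simp
  rw [this]; ring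

lemma BfF_ge {ν ε x : ℝ} (hν : -2 < ν) (hε : 0 < ε) (hx : 0 < x) : sgF ε x ≤ BfF ν ε x := by
  have h2 : 0 < ν + 2 := by linarith
  have e : sgF ε x = ∫ y in Ioo 0 x, (sgF ε x / x * (ν + 2) * x ^ (-ν - 1)) * y ^ (ν + 1) := by
    rw [integral_const_mul, rpow_setIntegral (by linarith) x hx]
    have : x ^ (-ν - 1) * x ^ (ν + 1 + 1) = x := by
      rw [← Real.rpow_add hx]; ring_nf; simp
    have h3 : ν + 1 + 1 ≠ 0 := by linarith
    field_simp
    calc sgF ε x * x * (ν + 1 + 1) = sgF ε x * (ν+2) * (x ^ (-ν - 1) * x ^ (ν + 1 + 1)) := by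
          rw [this]; ring
      _ = _ := by ring_nf
  rw [e]
  refine setIntegral_mono_on ((rpow_integrableOn (by linarith) x hx).const_mul _)
    (B_integrable hν hε hx) measurableSet_Ioo fun y hy => ?_
  have hy0 : 0 < y := hy.1
  rw [Real.rpow_add_one hy0.ne']
  have : sgF ε x / x * y ≤ sgF ε y := by
    unfold sgF
    rw [div_div, div_mul_eq_mul_div, div_le_div_iff₀ (by positivity) hε]
    have : min x ε * y ≤ min y ε * x := by
      rcases le_total y ε with h | h
      · rw [min_eq_left h, mul_comm]; gcongr; exact min_le_left _ _
      · rw [min_eq_right h]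
        exact mul_le_mul (min_le_right _ _) hy.2.le hy0.le hε.le
    nlinarith
  calc _ = (sgF ε x / x * y) * ((ν + 2) * y ^ ν * x ^ (-ν - 1)) := by ring
    _ ≤ _ := by gcongr

lemma BfF_lower {ν ε x : ℝ} (hν : ν ∈ Ioc (-2:ℝ) (-1)) (hε : 0 < ε) (hx : ε ≤ x) :
    (x / ε) ^ (-ν - 1) + (ν + 2) * Real.log (x / ε) ≤ BfF ν ε x := by
  obtain ⟨hν1, hν2⟩ := hν
  have h2 : 0 < ν + 2 := by linarith
  have hx0 : 0 < x := hε.trans_le hx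
  have hI := B_integrable hν1 hε hx0
  have hu : Ioo 0 x = Ioo 0 ε ∪ Ico ε x := (Ioo_union_Ico_eq_Ioo hε hx).symm
  unfold BfF
  have hI1 := hI.mono_set (Ioo_subset_Ioo_right hx : Ioo 0 ε ⊆ Ioo 0 x)
  have hI2 := hI.mono_set (fun y hy => ⟨hε.trans_le hy.1, hy.2⟩ : Ico ε x ⊆ Ioo 0 x)
  rw [hu, setIntegral_union (by
    rw [Set.disjoint_left]; intro y hy hy2; exact absurd hy.2 (not_lt.2 hy2.1))
    measurableSet_Ico hI1 hI2]
  apply add_le_add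
  · apply le_of_eq
    have : ∀ y ∈ Ioo 0 ε, sgF ε y * ((ν + 2) * y ^ ν * x ^ (-ν - 1)) =
        ((ν + 2) * x ^ (-ν - 1) / ε) * y ^ (ν + 1) := by
      intro y hy
      rw [Real.rpow_add_one hy.1.ne', sgF, min_eq_left hy.2.le]; ring
    rw [setIntegral_congr_fun measurableSet_Ioo this, integral_const_mul,
      rpow_setIntegral (by linarith) ε hε, Real.div_rpow hx0.le hε.le]
    have h3 : ν + 1 + 1 ≠ 0 := by linarith
    have : ε ^ (ν + 1 + 1) = ε * (ε ^ (-ν - 1))⁻¹ := by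
      rw [Real.rpow_add_one hε.ne', ← Real.rpow_neg hε.le]; ring_nf
    rw [this]
    have h4 : ε ^ (-ν - 1) ≠ 0 := by positivity
    field_simp
    ring
  · have hii : IntervalIntegrable (fun y : ℝ => y⁻¹) volume ε x :=
      intervalIntegral.intervalIntegrable_inv (fun y hy => by
        rw [uIcc_of_le hx] at hy; exact (hε.trans_le hy.1).ne') continuousOn_id
    have e : (ν + 2) * Real.log (x / ε) = ∫ y in Ico ε x, (ν + 2) * y⁻¹ := by
      rw [integral_const_mul, integral_Ico_eq_integral_Ioc,
        ← intervalIntegral.integral_of_le hx, integral_inv_of_pos hε hx0]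
    rw [e]
    rw [intervalIntegrable_iff_integrableOn_Ico_of_le hx] at hii
    refine setIntegral_mono_on (hii.const_mul _) hI2 measurableSet_Ico fun y hy => ?_
    have hy0 : 0 < y := hε.trans_le hy.1
    rw [sgF, min_eq_right hy.1, div_self hε.ne', one_mul, mul_assoc]
    gcongr
    calc y⁻¹ = y ^ ν * y ^ (-ν - 1) := by
          rw [← Real.rpow_add hy0, ← Real.rpow_neg_one]; ring_nf
      _ ≤ _ := by
        gcongr
        · linarith
        · exact hy.2.le

lemma BfF_upper {ν ε x k : ℝ} (hν : ν ∈ Ioc (-2:ℝ) (-1)) (hε : 0 < ε) (hx : 0 < x)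
    (hk : -ν - 1 < k) (hk1 : k < 1) :
    BfF ν ε x ≤ ((ν + 2) / ε ^ k / (ν + k + 1)) * x ^ k := by
  obtain ⟨hν1, hν2⟩ := hν
  have h2 : 0 < ν + 2 := by linarith
  have e : ((ν + 2) / ε ^ k / (ν + k + 1)) * x ^ k =
      ∫ y in Ioo 0 x, ((ν + 2) / ε ^ k * x ^ (-ν - 1)) * y ^ (ν + k) := by
    rw [integral_const_mul, rpow_setIntegral (by linarith) x hx]
    have : x ^ k = x ^ (-ν - 1) * x ^ (ν + k + 1) := by
      rw [← Real.rpow_add hx]; ring_nf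
    rw [this]; ring
  rw [e]
  refine setIntegral_mono_on (B_integrable hν1 hε hx)
    ((rpow_integrableOn (by linarith) x hx).const_mul _) measurableSet_Ioo fun y hy => ?_
  have hy0 : 0 < y := hy.1
  rw [Real.rpow_add hy0]
  have := sgF_le_rpow (k := k) hε hy0 (by linarith) hk1.le
  rw [Real.div_rpow hy0.le hε.le] at this
  calc _ ≤ (y ^ k / ε ^ k) * ((ν + 2) * y ^ ν * x ^ (-ν - 1)) := by gcongr
    _ = _ := by ring

lemma BfF_meas (ν ε : ℝ) : Measurable (BfF ν ε) := by
  have : BfF ν ε = fun x => ∫ y, (fun q : ℝ × ℝ => {q : ℝ × ℝ | 0 < q.2 ∧ q.2 < q.1}.indicator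
      (fun q => sgF ε q.2 * ((ν + 2) * q.2 ^ ν * q.1 ^ (-ν - 1))) q) (x, y) := by
    ext x
    rw [BfF, ← integral_indicator measurableSet_Ioo]
    rfl
  rw [this]
  have hs : MeasurableSet {q : ℝ × ℝ | 0 < q.2 ∧ q.2 < q.1} :=
    (measurableSet_lt measurable_const measurable_snd).inter
      (measurableSet_lt measurable_snd measurable_fst)
  have hm : Measurable (fun q : ℝ × ℝ => sgF ε q.2 * ((ν + 2) * q.2 ^ ν * q.1 ^ (-ν - 1))) := by
    have := sgF_meas ε
    fun_prop
  exact (hm.indicator hs).stronglyMeasurable.integral_prod_right'.measurable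

lemma Phi_pos {l₁ l₂ x y : ℝ} (hx : 0 < x) (hy : 0 < y) : 0 < Phi l₁ l₂ x y := by
  unfold Phi; positivity

lemma Phi_meas (l₁ l₂ : ℝ) : Measurable (fun q : ℝ × ℝ => Phi l₁ l₂ q.1 q.2) := by
  unfold Phi; fun_prop

/-- The collision density. -/
noncomputable def GF (l₁ l₂ : ℝ) (u : ℝ → ℝ → ℝ) (q : ℝ × ℝ × ℝ) : ℝ :=
  Phi l₁ l₂ q.2.1 q.2.2 * u q.1 q.2.1 * u q.1 q.2.2

lemma GF_meas (l₁ l₂ : ℝ) {u : ℝ → ℝ → ℝ} (hm : Measurable (Function.uncurry u)) :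
    Measurable (GF l₁ l₂ u) := by
  have h1 : Measurable (fun q : ℝ × ℝ × ℝ => u q.1 q.2.1) :=
    hm.comp (measurable_fst.prodMk measurable_snd.fst)
  have h2 : Measurable (fun q : ℝ × ℝ × ℝ => u q.1 q.2.2) :=
    hm.comp (measurable_fst.prodMk measurable_snd.snd)
  exact (((Phi_meas l₁ l₂).comp measurable_snd).mul h1).mul h2

section core

variable {ν k₀ l₁ l₂ T₁ : ℝ} {uin : ℝ → ℝ} {u : ℝ → ℝ → ℝ}

lemma core_integrable (hν : ν ∈ Ioc (-2:ℝ) (-1)) (hk₀ : k₀ ∈ Ioo (-ν - 1) 1)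
    (hu : IsWeakSolution k₀ (betaPow ν) (Phi l₁ l₂) uin (ENNReal.ofReal T₁) u)
    {t ε : ℝ} (ht : 0 < t) (htT : t < T₁) (hε : 0 < ε) :
    IntegrableOn (fun q : ℝ × ℝ × ℝ =>
      ((BfF ν ε q.2.1 - sgF ε q.2.1) + (BfF ν ε q.2.2 - sgF ε q.2.2)) * GF l₁ l₂ u q)
      (Ioo (0:ℝ) t ×ˢ (Ioi (0:ℝ) ×ˢ Ioi (0:ℝ))) := by
  have hI := hu.integ t ht ((ENNReal.ofReal_lt_ofReal_iff (ht.trans htT)).2 htT)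
  refine Integrable.mono' (hI.const_mul ((ν + 2) / ε ^ k₀ / (ν + k₀ + 1))) ?_ ?_
  · have h1 := BfF_meas ν ε
    have h2 := sgF_meas ε
    have h3 := GF_meas l₁ l₂ hu.meas
    exact (by fun_prop : Measurable _).aestronglyMeasurable
  · filter_upwards [ae_restrict_mem (measurableSet_Ioo.prod
      (measurableSet_Ioi.prod measurableSet_Ioi))] with q hq
    obtain ⟨hq1, hq2, hq3⟩ := hq
    have hx : 0 < q.2.1 := hq2
    have hy : 0 < q.2.2 := hq3
    have hT : ENNReal.ofReal q.1 < ENNReal.ofReal T₁ :=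
      (ENNReal.ofReal_lt_ofReal_iff (ht.trans htT)).2 (hq1.2.trans htT)
    have hG : 0 ≤ GF l₁ l₂ u q :=
      mul_nonneg (mul_nonneg (Phi_pos hx hy).le (hu.nonneg _ hq1.1.le hT _ hx))
        (hu.nonneg _ hq1.1.le hT _ hy)
    have a1 := BfF_ge hν.1 hε hx
    have a2 := BfF_ge hν.1 hε hy
    have b1 := BfF_upper hν hε hx hk₀.1 hk₀.2
    have b2 := BfF_upper hν hε hy hk₀.1 hk₀.2
    have c1 := sgF_nonneg hε hx.le
    have c2 := sgF_nonneg hε hy.le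
    rw [Real.norm_of_nonneg (mul_nonneg (by linarith) hG)]
    calc _ ≤ ((ν + 2) / ε ^ k₀ / (ν + k₀ + 1) * q.2.1 ^ k₀ +
          (ν + 2) / ε ^ k₀ / (ν + k₀ + 1) * q.2.2 ^ k₀) * GF l₁ l₂ u q :=
          mul_le_mul_of_nonneg_right (by linarith) hG
      _ = _ := by unfold GF; ring

lemma G_integrable (hk0 : 0 < k₀)
    (hu : IsWeakSolution k₀ (betaPow ν) (Phi l₁ l₂) uin (ENNReal.ofReal T₁) u)
    {t a : ℝ} (ht : 0 < t) (htT : t < T₁) (ha : 0 < a) :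
    IntegrableOn (GF l₁ l₂ u) (Ioo (0:ℝ) t ×ˢ (Ioi a ×ˢ Ioi a)) := by
  have hI := hu.integ t ht ((ENNReal.ofReal_lt_ofReal_iff (ht.trans htT)).2 htT)
  have hI' := hI.mono_set (prod_mono le_rfl (prod_mono (Ioi_subset_Ioi ha.le)
    (Ioi_subset_Ioi ha.le)) : Ioo (0:ℝ) t ×ˢ (Ioi a ×ˢ Ioi a) ⊆ _)
  refine Integrable.mono' (hI'.const_mul ((a ^ k₀)⁻¹))
    (GF_meas l₁ l₂ hu.meas).aestronglyMeasurable ?_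
  filter_upwards [ae_restrict_mem (measurableSet_Ioo.prod
      (measurableSet_Ioi.prod measurableSet_Ioi))] with q hq
  obtain ⟨hq1, hq2, hq3⟩ := hq
  have hx : 0 < q.2.1 := ha.trans hq2
  have hy : 0 < q.2.2 := ha.trans hq3
  have hT : ENNReal.ofReal q.1 < ENNReal.ofReal T₁ :=
    (ENNReal.ofReal_lt_ofReal_iff (ht.trans htT)).2 (hq1.2.trans htT)
  have hG : 0 ≤ GF l₁ l₂ u q :=
    mul_nonneg (mul_nonneg (Phi_pos hx hy).le (hu.nonneg _ hq1.1.le hT _ hx))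
      (hu.nonneg _ hq1.1.le hT _ hy)
  rw [Real.norm_of_nonneg hG]
  have h1 : a ^ k₀ ≤ q.2.1 ^ k₀ := Real.rpow_le_rpow ha.le (le_of_lt hq2) hk0.le
  have h2 : 0 ≤ q.2.2 ^ k₀ := by positivity
  have h3 : 0 < a ^ k₀ := by positivity
  calc GF l₁ l₂ u q = (a ^ k₀)⁻¹ * (a ^ k₀ * GF l₁ l₂ u q) := by field_simp
    _ ≤ (a ^ k₀)⁻¹ * ((q.2.1 ^ k₀ + q.2.2 ^ k₀) * GF l₁ l₂ u q) := by
      gcongr; linarith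
    _ = _ := by unfold GF; ring

lemma core_ineq (hν : ν ∈ Ioc (-2:ℝ) (-1)) (hk₀ : k₀ ∈ Ioo (-ν - 1) 1)
    (hnn : ∀ x : ℝ, 0 ≤ uin x)
    (hu : IsWeakSolution k₀ (betaPow ν) (Phi l₁ l₂) uin (ENNReal.ofReal T₁) u)
    {t ε a : ℝ} (ht : 0 < t) (htT : t < T₁) (hε : 0 < ε) (ha : ε ≤ a) :
    ((a / ε) ^ (-ν - 1) - 1 + (ν + 2) * Real.log (a / ε)) *
      (∫ q in Ioo (0:ℝ) t ×ˢ (Ioi a ×ˢ Ioi a), GF l₁ l₂ u q) ≤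
      ∫ x in Ioi (0:ℝ), sgF ε x * u t x := by
  have ha0 : 0 < a := hε.trans_le ha
  have hν1 := hν.1
  have hν2 := hν.2
  have hk0 : 0 < k₀ := by have := hk₀.1; linarith
  have hTT := (ENNReal.ofReal_lt_ofReal_iff (ht.trans htT)).2 htT
  have hw := hu.weak t ht hTT (sgF ε) (sgF_holder hε hk0 hk₀.2.le)
    ⟨1, fun x hx => by rw [abs_of_nonneg (sgF_nonneg hε hx)]; exact sgF_le_one x hε⟩
  set S := Ioo (0:ℝ) t ×ˢ (Ioi (0:ℝ) ×ˢ Ioi (0:ℝ)) with hS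
  set S' := Ioo (0:ℝ) t ×ˢ (Ioi a ×ˢ Ioi a) with hS'
  have hSm : MeasurableSet S := measurableSet_Ioo.prod (measurableSet_Ioi.prod measurableSet_Ioi)
  have hSm' : MeasurableSet S' :=
    measurableSet_Ioo.prod (measurableSet_Ioi.prod measurableSet_Ioi)
  have hsub : S' ⊆ S := prod_mono le_rfl (prod_mono (Ioi_subset_Ioi ha0.le)
    (Ioi_subset_Ioi ha0.le))
  set F : ℝ × ℝ × ℝ → ℝ := fun q =>
      ((BfF ν ε q.2.1 - sgF ε q.2.1) + (BfF ν ε q.2.2 - sgF ε q.2.2)) * GF l₁ l₂ u q with hF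
  have hFI : IntegrableOn F S := core_integrable hν hk₀ hu ht htT hε
  have hG : ∀ q ∈ S, 0 ≤ GF l₁ l₂ u q := by
    rintro q ⟨hq1, hq2, hq3⟩
    have hT : ENNReal.ofReal q.1 < ENNReal.ofReal T₁ :=
      (ENNReal.ofReal_lt_ofReal_iff (ht.trans htT)).2 (hq1.2.trans htT)
    exact mul_nonneg (mul_nonneg (Phi_pos hq2 hq3).le (hu.nonneg _ hq1.1.le hT _ hq2))
        (hu.nonneg _ hq1.1.le hT _ hq3)
  have hFnn : ∀ q ∈ S, 0 ≤ F q := by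
    intro q hq
    have a1 := BfF_ge hν.1 hε hq.2.1
    have a2 := BfF_ge hν.1 hε hq.2.2
    exact mul_nonneg (by linarith) (hG q hq)
  have heq : (∫ τ in Ioo (0:ℝ) t, ∫ x₁ in Ioi (0:ℝ), ∫ x₂ in Ioi (0:ℝ),
        Upsilon (betaPow ν) (sgF ε) x₁ x₂ * Phi l₁ l₂ x₁ x₂ * u τ x₁ * u τ x₂) =
      ∫ q in S, F q := by
    have h1 : ∀ τ, (∫ x₁ in Ioi (0:ℝ), ∫ x₂ in Ioi (0:ℝ),
        Upsilon (betaPow ν) (sgF ε) x₁ x₂ * Phi l₁ l₂ x₁ x₂ * u τ x₁ * u τ x₂) =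
        ∫ x₁ in Ioi (0:ℝ), ∫ x₂ in Ioi (0:ℝ), F (τ, x₁, x₂) := by
      intro τ
      refine setIntegral_congr_fun measurableSet_Ioi fun x₁ hx₁ => ?_
      refine setIntegral_congr_fun measurableSet_Ioi fun x₂ hx₂ => ?_
      simp only [hF, GF]
      rw [ups_eq hν.1 hε hx₁ hx₂]; ring
    simp_rw [h1]
    have h0 : IntegrableOn F S (volume.prod (volume : Measure (ℝ × ℝ))) := hFI
    have h2 : ∫ q in S, F q = ∫ τ in Ioo (0:ℝ) t, ∫ y in Ioi (0:ℝ) ×ˢ Ioi (0:ℝ), F (τ, y) :=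
      setIntegral_prod F h0
    rw [h2]
    rw [IntegrableOn, hS, ← Measure.prod_restrict] at h0
    refine integral_congr_ae ?_
    filter_upwards [h0.prod_right_ae] with τ hτ
    have h3 : IntegrableOn (fun y => F (τ, y)) (Ioi (0:ℝ) ×ˢ Ioi (0:ℝ))
      ((volume : Measure ℝ).prod (volume : Measure ℝ)) := hτ
    exact (setIntegral_prod _ h3).symm
  rw [heq] at hw
  have hin : 0 ≤ ∫ x in Ioi (0:ℝ), sgF ε x * uin x :=
    setIntegral_nonneg measurableSet_Ioi fun x hx =>
      mul_nonneg (sgF_nonneg hε (le_of_lt hx)) (hnn x)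
  have hlow : 2 * ((a / ε) ^ (-ν - 1) - 1 + (ν + 2) * Real.log (a / ε)) *
      (∫ q in S', GF l₁ l₂ u q) ≤ ∫ q in S, F q := by
    calc _ = ∫ q in S', 2 * ((a / ε) ^ (-ν - 1) - 1 + (ν + 2) * Real.log (a / ε)) *
          GF l₁ l₂ u q := by rw [integral_const_mul]
      _ ≤ ∫ q in S', F q := by
        refine setIntegral_mono_on ((G_integrable hk0 hu ht htT ha0).const_mul _)
          (hFI.mono_set hsub) hSm' fun q hq => ?_
        refine mul_le_mul_of_nonneg_right ?_ (hG q (hsub hq))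
        have key : ∀ x, a < x → (a / ε) ^ (-ν - 1) - 1 + (ν + 2) * Real.log (a / ε) ≤
            BfF ν ε x - sgF ε x := by
          intro x hx
          have h1 := BfF_lower hν hε (ha.trans hx.le)
          have h2 := sgF_le_one x hε
          have h3 : (a / ε) ^ (-ν - 1) ≤ (x / ε) ^ (-ν - 1) := by
            gcongr; linarith
          have h4 : (ν + 2) * Real.log (a / ε) ≤ (ν + 2) * Real.log (x / ε) := by
            gcongr; linarith
          linarith
        have k1 := key _ hq.2.1
        have k2 := key _ hq.2.2
        linarith
      _ ≤ _ := setIntegral_mono_set hFI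
        ((ae_restrict_iff' hSm).2 (Eventually.of_forall hFnn)) hsub.eventuallyLE
  rw [hw]
  linarith

/-- Each time slice has positive mass. -/
lemma slice_not_ae_zero (hρ : 0 < Mk 1 uin) (hmc : MassConserving uin (ENNReal.ofReal T₁) u)
    {t : ℝ} (ht : 0 < t) (htT : t < T₁) :
    ¬ ∀ᵐ x ∂(volume.restrict (Ioi (0:ℝ))), u t x = 0 := by
  intro h
  have := hmc t ht.le ((ENNReal.ofReal_lt_ofReal_iff (ht.trans htT)).2 htT)
  rw [← this, Mk, integral_eq_zero_of_ae] at hρ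
  · exact lt_irrefl _ hρ
  · filter_upwards [h] with x hx
    simp [hx]

lemma exists_J_pos (hk0 : 0 < k₀) (hρ : 0 < Mk 1 uin)
    (hu : IsWeakSolution k₀ (betaPow ν) (Phi l₁ l₂) uin (ENNReal.ofReal T₁) u)
    (hmc : MassConserving uin (ENNReal.ofReal T₁) u)
    {t : ℝ} (ht : 0 < t) (htT : t < T₁) :
    ∃ a : ℝ, 0 < a ∧ 0 < ∫ q in Ioo (0:ℝ) t ×ˢ (Ioi a ×ˢ Ioi a), GF l₁ l₂ u q := by
  by_contra! hcon
  have hz : ∀ n : ℕ, ∀ᵐ q : ℝ × ℝ × ℝ,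
      q ∈ Ioo (0:ℝ) t ×ˢ (Ioi (1 / ((n:ℝ) + 1)) ×ˢ Ioi (1 / ((n:ℝ) + 1))) → GF l₁ l₂ u q = 0 := by
    intro n
    have ha : (0:ℝ) < 1 / ((n:ℝ) + 1) := by positivity
    set a := 1 / ((n:ℝ) + 1)
    have hSm' : MeasurableSet (Ioo (0:ℝ) t ×ˢ (Ioi a ×ˢ Ioi a)) :=
      measurableSet_Ioo.prod (measurableSet_Ioi.prod measurableSet_Ioi)
    have hG : ∀ q ∈ Ioo (0:ℝ) t ×ˢ (Ioi a ×ˢ Ioi a), 0 ≤ GF l₁ l₂ u q := by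
      rintro q ⟨hq1, hq2, hq3⟩
      have hT : ENNReal.ofReal q.1 < ENNReal.ofReal T₁ :=
        (ENNReal.ofReal_lt_ofReal_iff (ht.trans htT)).2 (hq1.2.trans htT)
      have hx : 0 < q.2.1 := ha.trans hq2
      have hy : 0 < q.2.2 := ha.trans hq3
      exact mul_nonneg (mul_nonneg (Phi_pos hx hy).le (hu.nonneg _ hq1.1.le hT _ hx))
        (hu.nonneg _ hq1.1.le hT _ hy)
    have h0 : ∫ q in Ioo (0:ℝ) t ×ˢ (Ioi a ×ˢ Ioi a), GF l₁ l₂ u q = 0 :=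
      le_antisymm (hcon a ha) (setIntegral_nonneg hSm' hG)
    rw [setIntegral_eq_zero_iff_of_nonneg_ae
      ((ae_restrict_iff' hSm').2 (Eventually.of_forall hG))
      (G_integrable hk0 hu ht htT ha)] at h0
    exact (ae_restrict_iff' hSm').1 h0
  have hz' : ∀ᵐ q : ℝ × ℝ × ℝ, q ∈ Ioo (0:ℝ) t ×ˢ (Ioi (0:ℝ) ×ˢ Ioi (0:ℝ)) →
      u q.1 q.2.1 * u q.1 q.2.2 = 0 := by
    filter_upwards [ae_all_iff.2 hz] with q hq hqS
    have hx : 0 < q.2.1 := hqS.2.1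
    have hy : 0 < q.2.2 := hqS.2.2
    obtain ⟨n, hn⟩ := exists_nat_one_div_lt (lt_min hx hy)
    have := hq n ⟨hqS.1, hn.trans_le (min_le_left _ _), hn.trans_le (min_le_right _ _)⟩
    rw [GF, mul_assoc] at this
    exact (mul_eq_zero.1 this).resolve_left (Phi_pos hx hy).ne'
  rw [← ae_restrict_iff' (measurableSet_Ioo.prod
      (measurableSet_Ioi.prod measurableSet_Ioi))] at hz'
  have hz2 : ∀ᵐ q ∂((volume.restrict (Ioo (0:ℝ) t)).prod
      ((volume.restrict (Ioi (0:ℝ))).prod (volume.restrict (Ioi (0:ℝ))))),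
      u q.1 q.2.1 * u q.1 q.2.2 = 0 := by
    rw [Measure.prod_restrict, Measure.prod_restrict]; exact hz'
  have hz3 := Measure.ae_ae_of_ae_prod hz2
  have : (ae (volume.restrict (Ioo (0:ℝ) t))).NeBot := by
    rw [ae_neBot, Ne, Measure.restrict_eq_zero]; simp [ht]
  obtain ⟨τ, hτ, hτI⟩ := (hz3.and (ae_restrict_mem measurableSet_Ioo)).exists
  have hz4 := Measure.ae_ae_of_ae_prod hτ
  have hnz := slice_not_ae_zero hρ hmc hτI.1 (hτI.2.trans htT)
  apply hnz
  filter_upwards [hz4] with x hx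
  by_contra hne
  apply hnz
  filter_upwards [hx] with y hy
  exact (mul_eq_zero.1 hy).resolve_left hne

lemma exists_moment (hρ : 0 < Mk 1 uin) (hT₁ : 0 < T₁)
    (hu : IsWeakSolution k₀ (betaPow ν) (Phi l₁ l₂) uin (ENNReal.ofReal T₁) u)
    (hmc : MassConserving uin (ENNReal.ofReal T₁) u) :
    ∃ t : ℝ, 0 < t ∧ t < T₁ ∧ IntegrableOn (fun x => x ^ l₁ * u t x) (Ioi 0) := by
  have ht : 0 < T₁ / 2 := by linarith
  have htT : T₁ / 2 < T₁ := by linarith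
  have hI := hu.integ (T₁ / 2) ht ((ENNReal.ofReal_lt_ofReal_iff hT₁).2 htT)
  have hI2 : Integrable (fun q : ℝ × ℝ × ℝ =>
        (q.2.1 ^ k₀ + q.2.2 ^ k₀) * Phi l₁ l₂ q.2.1 q.2.2 * u q.1 q.2.1 * u q.1 q.2.2)
      ((volume.restrict (Ioo (0:ℝ) (T₁ / 2))).prod
      ((volume.restrict (Ioi (0:ℝ))).prod (volume.restrict (Ioi (0:ℝ))))) := by
    rw [Measure.prod_restrict, Measure.prod_restrict]; exact hI
  have : (ae (volume.restrict (Ioo (0:ℝ) (T₁ / 2)))).NeBot := by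
    rw [ae_neBot, Ne, Measure.restrict_eq_zero]; simp [hT₁]
  obtain ⟨t, hτ, hτI⟩ := (hI2.prod_right_ae.and (ae_restrict_mem measurableSet_Ioo)).exists
  have htT' : t < T₁ := hτI.2.trans htT
  have hTT := (ENNReal.ofReal_lt_ofReal_iff hT₁).2 htT'
  refine ⟨t, hτI.1, htT', ?_⟩
  have hnz := slice_not_ae_zero hρ hmc hτI.1 htT'
  obtain ⟨x, ⟨hne, hx⟩, hx0⟩ := (((Filter.not_eventually.1 hnz).and_eventually
    hτ.prod_right_ae).and_eventually (ae_restrict_mem measurableSet_Ioi)).exists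
  have hx0' : 0 < x := hx0
  have hux : 0 < u t x := lt_of_le_of_ne (hu.nonneg t hτI.1.le hTT x hx0) (Ne.symm hne)
  have hc : 0 < x ^ k₀ * x ^ l₂ * u t x := by positivity
  have hmu : Measurable (u t) := hu.meas.comp (measurable_const.prodMk measurable_id)
  refine Integrable.mono' (hx.const_mul (x ^ k₀ * x ^ l₂ * u t x)⁻¹)
    ((by fun_prop : Measurable _).aestronglyMeasurable) ?_
  filter_upwards [ae_restrict_mem measurableSet_Ioi] with y hy
  have hy0 : 0 < y := hy
  have huy := hu.nonneg t hτI.1.le hTT y hy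
  rw [Real.norm_of_nonneg (by positivity), inv_mul_eq_div, le_div_iff₀ hc]
  have e1 : 0 ≤ x ^ k₀ * (x ^ l₁ * y ^ l₂) * u t x * u t y := by positivity
  have e2 : 0 ≤ y ^ k₀ * Phi l₁ l₂ x y * u t x * u t y := by
    have := Phi_pos (l₁ := l₁) (l₂ := l₂) hx0' hy0
    positivity
  calc _ ≤ y ^ l₁ * u t y * (x ^ k₀ * x ^ l₂ * u t x) +
        (x ^ k₀ * (x ^ l₁ * y ^ l₂) * u t x * u t y +
          y ^ k₀ * Phi l₁ l₂ x y * u t x * u t y) := by linarith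
    _ = _ := by simp only [Phi]; ring

lemma no_solution (hν : ν ∈ Ioc (-2:ℝ) (-1)) (hk₀ : k₀ ∈ Ioo (-ν - 1) 1)
    (hl₁ : l₁ < -ν - 1)
    (hnn : ∀ x : ℝ, 0 ≤ uin x) (hρ : 0 < Mk 1 uin) (hT₁ : 0 < T₁)
    (hu : IsWeakSolution k₀ (betaPow ν) (Phi l₁ l₂) uin (ENNReal.ofReal T₁) u)
    (hmc : MassConserving uin (ENNReal.ofReal T₁) u) : False := by
  obtain ⟨hν1, hν2⟩ := id hν
  have hk0 : 0 < k₀ := by have := hk₀.1; linarith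
  obtain ⟨t, ht, htT, hm⟩ := exists_moment hρ hT₁ hu hmc
  obtain ⟨a, ha, hJ⟩ := exists_J_pos hk0 hρ hu hmc ht htT
  have hTT := (ENNReal.ofReal_lt_ofReal_iff hT₁).2 htT
  set J := ∫ q in Ioo (0:ℝ) t ×ˢ (Ioi a ×ˢ Ioi a), GF l₁ l₂ u q with hJd
  have hmu : Measurable (u t) := hu.meas.comp (measurable_const.prodMk measurable_id)
  have hm1 : IntegrableOn (fun x => x ^ (1:ℝ) * u t x) (Ioi 0) := by
    by_contra h
    have h1 := hmc t ht.le hTT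
    rw [← h1, Mk, integral_undef h] at hρ
    exact lt_irrefl _ hρ
  -- the exponent
  set k := max l₁ 0 with hkd
  have hk00 : 0 ≤ k := le_max_right _ _
  have hk1 : k ≤ 1 := by apply max_le <;> linarith
  have hmk : IntegrableOn (fun x => x ^ k * u t x) (Ioi 0) := by
    refine Integrable.mono' (hm.add hm1)
      ((by fun_prop : Measurable _).aestronglyMeasurable) ?_
    filter_upwards [ae_restrict_mem measurableSet_Ioi] with x hx
    have hx0 : 0 < x := hx
    have hux := hu.nonneg t ht.le hTT x hx
    rw [Real.norm_of_nonneg (by positivity), Pi.add_apply, ← add_mul]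
    gcongr
    have p1 : 0 < x ^ l₁ := by positivity
    have p2 : 0 < x ^ (1:ℝ) := by positivity
    rcases le_total x 1 with h | h
    · have : x ^ k ≤ x ^ l₁ := Real.rpow_le_rpow_of_exponent_ge hx0 h (le_max_left _ _)
      exact this.trans (le_add_of_nonneg_right p2.le)
    · have : x ^ k ≤ x ^ (1:ℝ) := Real.rpow_le_rpow_of_exponent_le h hk1
      exact this.trans (le_add_of_nonneg_left p1.le)
  set M := ∫ x in Ioi (0:ℝ), x ^ k * u t x with hMd
  have hM : 0 ≤ M := setIntegral_nonneg measurableSet_Ioi fun x hx => by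
    have hx0 : 0 < x := hx
    have := hu.nonneg t ht.le hTT x hx
    positivity
  have main : ∀ s : ℝ, 1 ≤ s →
      (s ^ (-ν - 1) - 1 + (ν + 2) * Real.log s) * J ≤ s ^ k * (M / a ^ k) := by
    intro s hs
    have hs0 : 0 < s := by linarith
    have hε : 0 < a / s := by positivity
    have h := core_ineq hν hk₀ hnn hu ht htT hε (div_le_self ha.le hs)
    rw [div_div_cancel₀ ha.ne'] at h
    refine h.trans ?_
    have : s ^ k * (M / a ^ k) = ∫ x in Ioi (0:ℝ), (s ^ k / a ^ k) * (x ^ k * u t x) := by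
      rw [integral_const_mul]; ring
    rw [this]
    refine integral_mono_of_nonneg ?_ (hmk.const_mul _) ?_
    · filter_upwards [ae_restrict_mem measurableSet_Ioi] with x hx
      exact mul_nonneg (sgF_nonneg hε (le_of_lt hx)) (hu.nonneg t ht.le hTT x hx)
    · filter_upwards [ae_restrict_mem measurableSet_Ioi] with x hx
      have hx0 : 0 < x := hx
      have hux := hu.nonneg t ht.le hTT x hx
      have h1 := sgF_le_rpow hε hx0 hk00 hk1
      have h2 : (x / (a / s)) ^ k = s ^ k / a ^ k * x ^ k := by
        rw [← Real.div_rpow hs0.le ha.le, ← Real.mul_rpow (by positivity) hx0.le]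
        congr 1; field_simp
      rw [h2] at h1
      calc _ ≤ (s ^ k / a ^ k * x ^ k) * u t x := by gcongr
        _ = _ := by ring
  set D := M / a ^ k with hD
  have hD0 : 0 ≤ D := by positivity
  rcases hν2.eq_or_lt with hνe | hνl
  · -- borderline exponent: logarithmic divergence
    have hk : k = 0 := max_eq_right (by linarith)
    have hlim := Real.tendsto_log_atTop
    obtain ⟨s, hs, hs1⟩ := ((hlim.eventually_gt_atTop (D / J)).and (eventually_ge_atTop 1)).exists
    have := main s hs1
    rw [hk, hνe] at this
    norm_num at this
    rw [div_lt_iff₀ hJ] at hs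
    linarith
  · have hkp : k < -ν - 1 := max_lt hl₁ (by linarith)
    have hlim := tendsto_rpow_atTop (y := -ν - 1 - k) (by linarith)
    obtain ⟨s, hs, hs1⟩ := ((hlim.eventually_gt_atTop (D / J + 1)).and
      (eventually_ge_atTop 1)).exists
    have h := main s hs1
    have hs0 : 0 < s := by linarith
    have hsk : 1 ≤ s ^ k := Real.one_le_rpow hs1 hk00
    have hlog : 0 ≤ (ν + 2) * Real.log s :=
      mul_nonneg (by linarith) (Real.log_nonneg hs1)
    have e : s ^ (-ν - 1) = s ^ k * s ^ (-ν - 1 - k) := by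
      rw [← Real.rpow_add hs0]; ring_nf
    have h3 : D / J < s ^ (-ν - 1 - k) - 1 := by linarith
    rw [div_lt_iff₀ hJ] at h3
    have h4 : s ^ k * D < s ^ k * ((s ^ (-ν - 1 - k) - 1) * J) :=
      mul_lt_mul_of_pos_left h3 (by linarith)
    have h5 : s ^ k * ((s ^ (-ν - 1 - k) - 1) * J) ≤
        (s ^ (-ν - 1) - 1 + (ν + 2) * Real.log s) * J := by
      rw [← mul_assoc]
      refine mul_le_mul_of_nonneg_right ?_ hJ.le
      rw [e]; linarith
    linarith

end core

noncomputable section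

/-- For a mass-conserving weak solution in the power-law setting with
`λ₁ < |ν| − 1` and `λ < 1`, all moments of order `k < 1` are bounded on compact
subintervals `[0,T] ⊂ [0,T₁)`; in particular `u^in ∈ X_k` for every `k ≤ 1 + k₀`. -/
theorem negative_moments_finite
    (ν k₀ l₁ l₂ : ℝ) (hν : ν ∈ Ioc (-2:ℝ) (-1))
    (hk₀ : k₀ ∈ Ioo (|ν| - 1) 1)
    (hl₁₂ : l₁ ≤ l₂) (hl₂ : l₂ ≤ 1) (hl₁ : l₁ < |ν| - 1) (hlam : l₁ + l₂ < 1)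
    (uin : ℝ → ℝ) (hmeas : Measurable uin) (hnn : ∀ x : ℝ, 0 ≤ uin x)
    (hXk₀ : MemXk k₀ uin) (hXk₁ : MemXk (k₀ + 1) uin) (hρ : 0 < Mk 1 uin)
    (T₁ : ℝ) (hT₁ : 0 < T₁) (u : ℝ → ℝ → ℝ)
    (hu : IsWeakSolution k₀ (betaPow ν) (Phi l₁ l₂) uin (ENNReal.ofReal T₁) u)
    (hmc : MassConserving uin (ENNReal.ofReal T₁) u) :
    (∀ T : ℝ, 0 < T → T < T₁ → ∀ k : ℝ, k < 1 → ∃ C : ℝ,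
      ∀ t ∈ Icc (0:ℝ) T,
        (∫⁻ x in Ioi (0:ℝ), ENNReal.ofReal (x ^ k * u t x)) ≤ ENNReal.ofReal C) ∧
    (∀ k : ℝ, k ≤ 1 + k₀ → MemXk k uin) := by
  have hab : |ν| = -ν := abs_of_nonpos (by have := hν.2; linarith)
  rw [hab] at hk₀ hl₁
  exact (no_solution hν hk₀ hl₁ hnn hρ hT₁ hu hmc).elim

end
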